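/- Assume the limiting system (ODE-Λ) has a solution (Λ₁, Λ₂) on [0, T] and define Θ = ℛ₁(Λ₁)⁻¹BᵀΛ₁. For each N, let (Λ̌₁^N, Λ̌₂^N) be the unique solution on [0,T] of the linear system (ODE-Λ̌₁^N)–(ODE-Λ̌₂^N), and for N large let (Λ₁^N, Λ₂^N) be the solution of the rescaled system (ODE-Λ^N). Then there exist N₁ ≥ 1 and C > 0 such that for all N ≥ N₁, sup_{t∈[0,T]} |Λ̌₁^N(t) − Λ₁^N(t)| ≤ C/N (|·| the Frobenius norm). -/

import Mathlib

open Matrix Set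

namespace LQ

/-- Frobenius norm of a real matrix. -/
noncomputable def frob {a b : Type*} [Fintype a] [Fintype b] (M : Matrix a b ℝ) : ℝ :=
  Real.sqrt (∑ i, ∑ j, (M i j) ^ 2)

/-- Entrywise ℓ₁ norm of a real matrix. -/
noncomputable def l1norm {a b : Type*} [Fintype a] [Fintype b] (M : Matrix a b ℝ) : ℝ :=
  ∑ i, ∑ j, |M i j|

/-- Block matrix with all diagonal m×m blocks equal to `F` and all off-diagonal blocks equal to `K`. -/
def blockConst (N m : ℕ) (F K : Matrix (Fin m) (Fin m) ℝ) :
    Matrix (Fin N × Fin m) (Fin N × Fin m) ℝ :=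
  Matrix.of fun x y => if x.1 = y.1 then F x.2 y.2 else K x.2 y.2

/-- Block matrix with diagonal blocks `Λ₁` and off-diagonal blocks `Λ₂ / N`. -/
noncomputable def blockPN (N n : ℕ) (Λ₁ Λ₂ : Matrix (Fin n) (Fin n) ℝ) :
    Matrix (Fin N × Fin n) (Fin N × Fin n) ℝ :=
  Matrix.of fun x y => if x.1 = y.1 then Λ₁ x.2 y.2 else Λ₂ x.2 y.2 / (N : ℝ)

/-- The permutation matrix exchanging the i-th and j-th block rows of `I_{Nn}`. -/
def Jswap (N n : ℕ) (i j : Fin N) : Matrix (Fin N × Fin n) (Fin N × Fin n) ℝ :=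
  Matrix.of fun x y => if y.1 = Equiv.swap i j x.1 ∧ y.2 = x.2 then 1 else 0

/-- `I_N ⊗ M`. -/
def kronIN (N : ℕ) {a b : ℕ} (M : Matrix (Fin a) (Fin b) ℝ) :
    Matrix (Fin N × Fin a) (Fin N × Fin b) ℝ :=
  Matrix.of fun x y => if x.1 = y.1 then M x.2 y.2 else 0

/-- `𝟏_{N×1} ⊗ M`. -/
def stackN (N : ℕ) {a b : ℕ} (M : Matrix (Fin a) (Fin b) ℝ) :
    Matrix (Fin N × Fin a) (Fin b) ℝ :=
  Matrix.of fun x y => M x.2 y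

/-- Data of the LQ mean field social optimization problem. -/
structure Params (n n₁ : ℕ) where
  A : Matrix (Fin n) (Fin n) ℝ
  G : Matrix (Fin n) (Fin n) ℝ
  Γ : Matrix (Fin n) (Fin n) ℝ
  Γf : Matrix (Fin n) (Fin n) ℝ
  B : Matrix (Fin n) (Fin n₁) ℝ
  B0 : Matrix (Fin n) (Fin n₁) ℝ
  B1 : Matrix (Fin n) (Fin n₁) ℝ
  D : Matrix (Fin n) (Fin 1) ℝ
  D0 : Matrix (Fin n) (Fin 1) ℝ
  Q : Matrix (Fin n) (Fin n) ℝ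
  Qf : Matrix (Fin n) (Fin n) ℝ
  R : Matrix (Fin n₁) (Fin n₁) ℝ
  T : ℝ

namespace Params

variable {n n₁ : ℕ} (p : Params n n₁)

/-- Standing hypotheses: positive dimensions, positive horizon, symmetric weights. -/
def Standing : Prop :=
  1 ≤ n ∧ 1 ≤ n₁ ∧ 0 < p.T ∧ p.Q.IsSymm ∧ p.Qf.IsSymm ∧ p.R.IsSymm

/-- Q^Γ = Γᵀ Q Γ − Q Γ − Γᵀ Q. -/
def QΓ : Matrix (Fin n) (Fin n) ℝ := p.Γᵀ * p.Q * p.Γ - p.Q * p.Γ - p.Γᵀ * p.Q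

/-- Q_f^Γ = Γ_fᵀ Q_f Γ_f − Q_f Γ_f − Γ_fᵀ Q_f. -/
def QfΓ : Matrix (Fin n) (Fin n) ℝ := p.Γfᵀ * p.Qf * p.Γf - p.Qf * p.Γf - p.Γfᵀ * p.Qf

/-- ℛ₁(Λ₁) = R + B₁ᵀ Λ₁ B₁. -/
def R1 (Λ₁ : Matrix (Fin n) (Fin n) ℝ) : Matrix (Fin n₁) (Fin n₁) ℝ :=
  p.R + p.B1ᵀ * Λ₁ * p.B1

/-- ℛ₂(Λ₁,Λ₂) = R + B₁ᵀ Λ₁ B₁ + B₀ᵀ(Λ₁+Λ₂)B₀. -/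
def R2 (Λ₁ Λ₂ : Matrix (Fin n) (Fin n) ℝ) : Matrix (Fin n₁) (Fin n₁) ℝ :=
  p.R + p.B1ᵀ * Λ₁ * p.B1 + p.B0ᵀ * (Λ₁ + Λ₂) * p.B0

/-- Ψ₁. -/
noncomputable def Ψ₁ (Λ₁ : Matrix (Fin n) (Fin n) ℝ) : Matrix (Fin n) (Fin n) ℝ :=
  Λ₁ * p.B * (p.R1 Λ₁)⁻¹ * p.Bᵀ * Λ₁ - Λ₁ * p.A - p.Aᵀ * Λ₁ - p.Q

/-- Ψ₂. -/
noncomputable def Ψ₂ (Λ₁ Λ₂ : Matrix (Fin n) (Fin n) ℝ) : Matrix (Fin n) (Fin n) ℝ :=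
  (Λ₁ + Λ₂) * p.B * (p.R2 Λ₁ Λ₂)⁻¹ * p.Bᵀ * (Λ₁ + Λ₂)
    - Λ₁ * p.B * (p.R1 Λ₁)⁻¹ * p.Bᵀ * Λ₁
    - (Λ₁ * p.G + Λ₂ * (p.A + p.G))
    - (p.Gᵀ * Λ₁ + (p.Aᵀ + p.Gᵀ) * Λ₂)
    - p.QΓ

/-- Solution of the limiting ODE system (ODE-Λ) on [0,T]. -/
noncomputable def IsSolLim (Λ₁ Λ₂ : ℝ → Matrix (Fin n) (Fin n) ℝ) : Prop :=
  (∀ t ∈ Icc (0 : ℝ) p.T, (Λ₁ t).IsSymm ∧ (Λ₂ t).IsSymm) ∧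
  (∀ t ∈ Icc (0 : ℝ) p.T, (p.R1 (Λ₁ t)).PosDef ∧ (p.R2 (Λ₁ t) (Λ₂ t)).PosDef) ∧
  Λ₁ p.T = p.Qf ∧ Λ₂ p.T = p.QfΓ ∧
  (∀ t ∈ Icc (0 : ℝ) p.T, ∀ i j, HasDerivWithinAt (fun s => Λ₁ s i j)
    (p.Ψ₁ (Λ₁ t) i j) (Icc (0 : ℝ) p.T) t) ∧
  (∀ t ∈ Icc (0 : ℝ) p.T, ∀ i j, HasDerivWithinAt (fun s => Λ₂ s i j)
    (p.Ψ₂ (Λ₁ t) (Λ₂ t) i j) (Icc (0 : ℝ) p.T) t)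

/-! Big (N-agent) matrices. -/

noncomputable def bigA (N : ℕ) : Matrix (Fin N × Fin n) (Fin N × Fin n) ℝ :=
  Matrix.of fun x y => (if x.1 = y.1 then p.A x.2 y.2 else 0) + p.G x.2 y.2 / (N : ℝ)

def bigBhat (N : ℕ) : Matrix (Fin N × Fin n) (Fin N × Fin n₁) ℝ :=
  Matrix.of fun x y => if x.1 = y.1 then p.B x.2 y.2 else 0

def bigB (N : ℕ) (i : Fin N) : Matrix (Fin N × Fin n) (Fin n₁) ℝ :=
  Matrix.of fun x l => if x.1 = i then p.B1 x.2 l else 0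

noncomputable def bigB0 (N : ℕ) : Matrix (Fin N × Fin n) (Fin n₁) ℝ :=
  Matrix.of fun x l => p.B0 x.2 l / (N : ℝ)

def bigD (N : ℕ) (i : Fin N) : Matrix (Fin N × Fin n) (Fin 1) ℝ :=
  Matrix.of fun x l => if x.1 = i then p.D x.2 l else 0

def bigD0 (N : ℕ) : Matrix (Fin N × Fin n) (Fin 1) ℝ :=
  Matrix.of fun x l => p.D0 x.2 l

def bigE (_p : Params n n₁) (N : ℕ) (i : Fin N) : Matrix (Fin n₁) (Fin N × Fin n₁) ℝ :=
  Matrix.of fun k y => if y.1 = i ∧ y.2 = k then 1 else 0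

def bigIhat (_p : Params n n₁) (N : ℕ) : Matrix (Fin n₁) (Fin N × Fin n₁) ℝ :=
  Matrix.of fun k y => if y.2 = k then 1 else 0

noncomputable def bigQ (N : ℕ) : Matrix (Fin N × Fin n) (Fin N × Fin n) ℝ :=
  Matrix.of fun x y => (if x.1 = y.1 then p.Q x.2 y.2 else 0) + p.QΓ x.2 y.2 / (N : ℝ)

noncomputable def bigQf (N : ℕ) : Matrix (Fin N × Fin n) (Fin N × Fin n) ℝ :=
  Matrix.of fun x y => (if x.1 = y.1 then p.Qf x.2 y.2 else 0) + p.QfΓ x.2 y.2 / (N : ℝ)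

def bigR (N : ℕ) : Matrix (Fin N × Fin n₁) (Fin N × Fin n₁) ℝ :=
  Matrix.of fun x y => if x.1 = y.1 then p.R x.2 y.2 else 0

/-- 𝓜₀. -/
noncomputable def M0 (N : ℕ) (Z : Matrix (Fin N × Fin n) (Fin N × Fin n) ℝ) :
    Matrix (Fin 1) (Fin 1) ℝ :=
  (1 / 2 : ℝ) • (∑ i : Fin N, (p.bigD N i)ᵀ * Z * p.bigD N i)
    + (1 / 2 : ℝ) • ((p.bigD0 N)ᵀ * Z * p.bigD0 N)

/-- 𝓜₁. -/
noncomputable def M1 (N : ℕ) (Z : Matrix (Fin N × Fin n) (Fin N × Fin n) ℝ) :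
    Matrix (Fin 1) (Fin N × Fin n₁) ℝ :=
  (∑ i : Fin N, (p.bigD N i)ᵀ * Z * p.bigB N i * p.bigE N i)
    + (p.bigD0 N)ᵀ * Z * p.bigB0 N * p.bigIhat N

/-- 𝓜₂. -/
noncomputable def M2 (N : ℕ) (Z : Matrix (Fin N × Fin n) (Fin N × Fin n) ℝ) :
    Matrix (Fin N × Fin n₁) (Fin N × Fin n₁) ℝ :=
  (1 / 2 : ℝ) • (∑ i : Fin N, (p.bigE N i)ᵀ * (p.bigB N i)ᵀ * Z * p.bigB N i * p.bigE N i)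
    + (1 / 2 : ℝ) • ((p.bigIhat N)ᵀ * (p.bigB0 N)ᵀ * Z * p.bigB0 N * p.bigIhat N)

/-- Right-hand side of the Riccati equation (ODE-P). -/
noncomputable def PRic (N : ℕ) (P : Matrix (Fin N × Fin n) (Fin N × Fin n) ℝ) :
    Matrix (Fin N × Fin n) (Fin N × Fin n) ℝ :=
  P * p.bigBhat N * (p.bigR N + (2 : ℝ) • p.M2 N P)⁻¹ * (p.bigBhat N)ᵀ * P
    - P * p.bigA N - (p.bigA N)ᵀ * P - p.bigQ N

/-- Solution of the large-scale Riccati equation (ODE-P) on [0,T]. -/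
noncomputable def IsSolP (N : ℕ) (P : ℝ → Matrix (Fin N × Fin n) (Fin N × Fin n) ℝ) : Prop :=
  (∀ t ∈ Icc (0 : ℝ) p.T, (P t).IsSymm) ∧
  (∀ t ∈ Icc (0 : ℝ) p.T, (p.bigR N + (2 : ℝ) • p.M2 N (P t)).PosDef) ∧
  P p.T = p.bigQf N ∧
  (∀ t ∈ Icc (0 : ℝ) p.T, ∀ x y, HasDerivWithinAt (fun s => P s x y)
    (p.PRic N (P t) x y) (Icc (0 : ℝ) p.T) t)

/-- Solution of the companion linear equation (ODE-S) on [0,T], relative to `P`. -/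
noncomputable def IsSolS (N : ℕ) (P : ℝ → Matrix (Fin N × Fin n) (Fin N × Fin n) ℝ)
    (S : ℝ → Matrix (Fin N × Fin n) (Fin 1) ℝ) : Prop :=
  S p.T = 0 ∧
  (∀ t ∈ Icc (0 : ℝ) p.T, ∀ x y, HasDerivWithinAt (fun s => S s x y)
    ((P t * p.bigBhat N * (p.bigR N + (2 : ℝ) • p.M2 N (P t))⁻¹ *
        ((p.bigBhat N)ᵀ * S t + (p.M1 N (P t))ᵀ) - (p.bigA N)ᵀ * S t) x y)
    (Icc (0 : ℝ) p.T) t)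

/-- Solution of the companion scalar equation (ODE-r) on [0,T], relative to `P` and `S`. -/
noncomputable def IsSolr (N : ℕ) (P : ℝ → Matrix (Fin N × Fin n) (Fin N × Fin n) ℝ)
    (S : ℝ → Matrix (Fin N × Fin n) (Fin 1) ℝ) (r : ℝ → ℝ) : Prop :=
  r p.T = 0 ∧
  (∀ t ∈ Icc (0 : ℝ) p.T, HasDerivWithinAt r
    (((((S t)ᵀ * p.bigBhat N + p.M1 N (P t)) * (p.bigR N + (2 : ℝ) • p.M2 N (P t))⁻¹ *
        ((p.bigBhat N)ᵀ * S t + (p.M1 N (P t))ᵀ)) - (2 : ℝ) • p.M0 N (P t)) 0 0)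
    (Icc (0 : ℝ) p.T) t)

/-- Asymptotic solvability of the LQ mean field social optimization problem. -/
noncomputable def AsympSolvable : Prop :=
  ∃ N₀ : ℕ, 1 ≤ N₀ ∧ ∃ c₀ : ℝ, 0 < c₀ ∧ ∃ C : ℝ,
    ∀ N : ℕ, N₀ ≤ N →
      ∃ P : ℝ → Matrix (Fin N × Fin n) (Fin N × Fin n) ℝ,
        p.IsSolP N P ∧
        (∀ t ∈ Icc (0 : ℝ) p.T, l1norm (P t) / (N : ℝ) ≤ C) ∧
        (∀ t ∈ Icc (0 : ℝ) p.T,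
          (p.bigR N + (2 : ℝ) • p.M2 N (P t) - c₀ • 1).PosSemidef)

/-! The rescaled low-dimensional system. -/

/-- E^N. -/
noncomputable def EN (N : ℕ) (Λ₁ Λ₂ : Matrix (Fin n) (Fin n) ℝ) :
    Matrix (Fin n₁) (Fin n₁) ℝ :=
  (1 / (N : ℝ)) •
    ((p.R2 Λ₁ Λ₂ - (1 / (N : ℝ)) • (p.B0ᵀ * Λ₂ * p.B0))⁻¹ - (p.R1 Λ₁)⁻¹)

/-- H^N. -/
noncomputable def HN (N : ℕ) (Λ₁ Λ₂ : Matrix (Fin n) (Fin n) ℝ) :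
    Matrix (Fin n₁) (Fin n₁) ℝ :=
  p.EN N Λ₁ Λ₂ + (p.R1 Λ₁)⁻¹

/-- g₁. -/
noncomputable def g₁ (N : ℕ) (Λ₁ Λ₂ : Matrix (Fin n) (Fin n) ℝ) :
    Matrix (Fin n) (Fin n) ℝ :=
  Λ₁ * p.B * p.EN N Λ₁ Λ₂ * p.Bᵀ * Λ₁
  + (1 - 1 / (N : ℝ)) •
      (Λ₂ * p.B * p.EN N Λ₁ Λ₂ * p.Bᵀ * Λ₁ + Λ₁ * p.B * p.EN N Λ₁ Λ₂ * p.Bᵀ * Λ₂)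
  + (1 / (N : ℝ) - 1 / (N : ℝ) ^ 2) •
      (Λ₂ * p.B * (p.HN N Λ₁ Λ₂ + ((N : ℝ) - 2) • p.EN N Λ₁ Λ₂) * p.Bᵀ * Λ₂)
  - (1 / (N : ℝ)) •
      ((Λ₁ * p.G + p.Gᵀ * Λ₁) + (1 - 1 / (N : ℝ)) • (Λ₂ * p.G + p.Gᵀ * Λ₂))
  - (1 / (N : ℝ)) • p.QΓ

/-- g₂. -/
noncomputable def g₂ (N : ℕ) (Λ₁ Λ₂ : Matrix (Fin n) (Fin n) ℝ) :
    Matrix (Fin n) (Fin n) ℝ :=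
  (Λ₁ + Λ₂) * p.B *
      ((N : ℝ) • p.EN N Λ₁ Λ₂ + (p.R1 Λ₁)⁻¹ - (p.R2 Λ₁ Λ₂)⁻¹) * p.Bᵀ * (Λ₁ + Λ₂)
  - (2 / (N : ℝ)) • (Λ₂ * p.B * (p.R1 Λ₁)⁻¹ * p.Bᵀ * Λ₂)
  + (1 / (N : ℝ) - 2) • (Λ₂ * p.B * p.EN N Λ₁ Λ₂ * p.Bᵀ * Λ₂)
  - Λ₁ * p.B * p.EN N Λ₁ Λ₂ * p.Bᵀ * Λ₂
  - Λ₂ * p.B * p.EN N Λ₁ Λ₂ * p.Bᵀ * Λ₁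
  + (1 / (N : ℝ)) • (Λ₂ * p.G + p.Gᵀ * Λ₂)

/-- Solution of the rescaled system (ODE-Λ^N) on [0,T]. -/
noncomputable def IsSolLamN (N : ℕ) (Λ₁ Λ₂ : ℝ → Matrix (Fin n) (Fin n) ℝ) : Prop :=
  (∀ t ∈ Icc (0 : ℝ) p.T, (Λ₁ t).IsSymm ∧ (Λ₂ t).IsSymm) ∧
  (∀ t ∈ Icc (0 : ℝ) p.T, (p.R1 (Λ₁ t)).PosDef ∧ (p.R2 (Λ₁ t) (Λ₂ t)).PosDef ∧
    (p.R2 (Λ₁ t) (Λ₂ t) - (1 / (N : ℝ)) • (p.B0ᵀ * Λ₂ t * p.B0)).PosDef) ∧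
  Λ₁ p.T = p.Qf + (1 / (N : ℝ)) • p.QfΓ ∧ Λ₂ p.T = p.QfΓ ∧
  (∀ t ∈ Icc (0 : ℝ) p.T, ∀ i j, HasDerivWithinAt (fun s => Λ₁ s i j)
    ((p.Ψ₁ (Λ₁ t) + p.g₁ N (Λ₁ t) (Λ₂ t)) i j) (Icc (0 : ℝ) p.T) t) ∧
  (∀ t ∈ Icc (0 : ℝ) p.T, ∀ i j, HasDerivWithinAt (fun s => Λ₂ s i j)
    ((p.Ψ₂ (Λ₁ t) (Λ₂ t) + p.g₂ N (Λ₁ t) (Λ₂ t)) i j) (Icc (0 : ℝ) p.T) t)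

/-! Companion (mean-field) equations. -/

/-- φ₁. -/
noncomputable def φ₁ (Λ₁ Λ₂ : Matrix (Fin n) (Fin n) ℝ) (S : Matrix (Fin n) (Fin 1) ℝ) :
    Matrix (Fin n) (Fin 1) ℝ :=
  (Λ₁ + Λ₂) * p.B * (p.R2 Λ₁ Λ₂)⁻¹ *
      (p.Bᵀ * S + p.B1ᵀ * Λ₁ * p.D + p.B0ᵀ * (Λ₁ + Λ₂) * p.D0)
    - (p.A + p.G)ᵀ * S

/-- φ₂. -/
noncomputable def φ₂ (Λ₁ Λ₂ : Matrix (Fin n) (Fin n) ℝ) (S : Matrix (Fin n) (Fin 1) ℝ) :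
    Matrix (Fin 1) (Fin 1) ℝ :=
  (Sᵀ * p.B + p.Dᵀ * Λ₁ * p.B1 + p.D0ᵀ * (Λ₁ + Λ₂) * p.B0) * (p.R2 Λ₁ Λ₂)⁻¹ *
      (p.Bᵀ * S + p.B1ᵀ * Λ₁ * p.D + p.B0ᵀ * (Λ₁ + Λ₂) * p.D0)
    - p.Dᵀ * Λ₁ * p.D - p.D0ᵀ * (Λ₁ + Λ₂) * p.D0

/-- Solution of the limiting companion system (ODE-Sr) on [0,T]. -/
noncomputable def IsSolSr (Λ₁ Λ₂ : ℝ → Matrix (Fin n) (Fin n) ℝ)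
    (S : ℝ → Matrix (Fin n) (Fin 1) ℝ) (r : ℝ → ℝ) : Prop :=
  S p.T = 0 ∧ r p.T = 0 ∧
  (∀ t ∈ Icc (0 : ℝ) p.T, ∀ i j, HasDerivWithinAt (fun s => S s i j)
    (p.φ₁ (Λ₁ t) (Λ₂ t) (S t) i j) (Icc (0 : ℝ) p.T) t) ∧
  (∀ t ∈ Icc (0 : ℝ) p.T, HasDerivWithinAt r
    ((p.φ₂ (Λ₁ t) (Λ₂ t) (S t)) 0 0) (Icc (0 : ℝ) p.T) t)

/-- g₀₁. -/
noncomputable def g01 (N : ℕ) (Λ₁ Λ₂ : Matrix (Fin n) (Fin n) ℝ)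
    (S : Matrix (Fin n) (Fin 1) ℝ) : Matrix (Fin n) (Fin 1) ℝ :=
  (Λ₁ + (1 - 1 / (N : ℝ)) • Λ₂) * p.B *
      (p.R2 Λ₁ Λ₂ - (1 / (N : ℝ)) • (p.B0ᵀ * Λ₂ * p.B0))⁻¹ *
      (p.Bᵀ * S + p.B1ᵀ * Λ₁ * p.D + p.B0ᵀ * (Λ₁ + (1 - 1 / (N : ℝ)) • Λ₂) * p.D0)
  - (Λ₁ + Λ₂) * p.B * (p.R2 Λ₁ Λ₂)⁻¹ *
      (p.Bᵀ * S + p.B1ᵀ * Λ₁ * p.D + p.B0ᵀ * (Λ₁ + Λ₂) * p.D0)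

/-- g₀₂. -/
noncomputable def g02 (N : ℕ) (Λ₁ Λ₂ : Matrix (Fin n) (Fin n) ℝ)
    (S : Matrix (Fin n) (Fin 1) ℝ) : Matrix (Fin 1) (Fin 1) ℝ :=
  (Sᵀ * p.B + p.Dᵀ * Λ₁ * p.B1 + p.D0ᵀ * (Λ₁ + (1 - 1 / (N : ℝ)) • Λ₂) * p.B0) *
      (p.R2 Λ₁ Λ₂ - (1 / (N : ℝ)) • (p.B0ᵀ * Λ₂ * p.B0))⁻¹ *
      (p.Bᵀ * S + p.B1ᵀ * Λ₁ * p.D + p.B0ᵀ * (Λ₁ + (1 - 1 / (N : ℝ)) • Λ₂) * p.D0)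
  - (Sᵀ * p.B + p.Dᵀ * Λ₁ * p.B1 + p.D0ᵀ * (Λ₁ + Λ₂) * p.B0) * (p.R2 Λ₁ Λ₂)⁻¹ *
      (p.Bᵀ * S + p.B1ᵀ * Λ₁ * p.D + p.B0ᵀ * (Λ₁ + Λ₂) * p.D0)
  + (1 / (N : ℝ)) • (p.D0ᵀ * Λ₂ * p.D0)

/-- Solution of the rescaled companion system (ODE-S^N r^N) on [0,T]. -/
noncomputable def IsSolSrN (N : ℕ) (Λ₁ Λ₂ : ℝ → Matrix (Fin n) (Fin n) ℝ)
    (S : ℝ → Matrix (Fin n) (Fin 1) ℝ) (r : ℝ → ℝ) : Prop :=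
  S p.T = 0 ∧ r p.T = 0 ∧
  (∀ t ∈ Icc (0 : ℝ) p.T, ∀ i j, HasDerivWithinAt (fun s => S s i j)
    ((p.φ₁ (Λ₁ t) (Λ₂ t) (S t) + p.g01 N (Λ₁ t) (Λ₂ t) (S t)) i j) (Icc (0 : ℝ) p.T) t) ∧
  (∀ t ∈ Icc (0 : ℝ) p.T, HasDerivWithinAt r
    ((p.φ₂ (Λ₁ t) (Λ₂ t) (S t) + p.g02 N (Λ₁ t) (Λ₂ t) (S t)) 0 0) (Icc (0 : ℝ) p.T) t)

/-! Feedback gains. -/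

/-- Θ = ℛ₁(Λ₁)⁻¹ Bᵀ Λ₁. -/
noncomputable def Theta (Λ₁ : Matrix (Fin n) (Fin n) ℝ) : Matrix (Fin n₁) (Fin n) ℝ :=
  (p.R1 Λ₁)⁻¹ * p.Bᵀ * Λ₁

/-- Θ₁ = (H₁ − H)Bᵀ(Λ₁+Λ₂) + HBᵀΛ₂. -/
noncomputable def Theta1 (Λ₁ Λ₂ : Matrix (Fin n) (Fin n) ℝ) : Matrix (Fin n₁) (Fin n) ℝ :=
  ((p.R2 Λ₁ Λ₂)⁻¹ - (p.R1 Λ₁)⁻¹) * p.Bᵀ * (Λ₁ + Λ₂) + (p.R1 Λ₁)⁻¹ * p.Bᵀ * Λ₂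

/-- Θ₂ = H₁[BᵀS + B₁ᵀΛ₁D + B₀ᵀ(Λ₁+Λ₂)D₀]. -/
noncomputable def Theta2 (Λ₁ Λ₂ : Matrix (Fin n) (Fin n) ℝ) (S : Matrix (Fin n) (Fin 1) ℝ) :
    Matrix (Fin n₁) (Fin 1) ℝ :=
  (p.R2 Λ₁ Λ₂)⁻¹ * (p.Bᵀ * S + p.B1ᵀ * Λ₁ * p.D + p.B0ᵀ * (Λ₁ + Λ₂) * p.D0)

/-- Θ^N. -/
noncomputable def ThetaN (N : ℕ) (Λ₁ Λ₂ : Matrix (Fin n) (Fin n) ℝ) :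
    Matrix (Fin n₁) (Fin n) ℝ :=
  (p.HN N Λ₁ Λ₂ - p.EN N Λ₁ Λ₂) * p.Bᵀ * (Λ₁ - (1 / (N : ℝ)) • Λ₂)

/-- Θ₁^N. -/
noncomputable def Theta1N (N : ℕ) (Λ₁ Λ₂ : Matrix (Fin n) (Fin n) ℝ) :
    Matrix (Fin n₁) (Fin n) ℝ :=
  (N : ℝ) • (p.EN N Λ₁ Λ₂ * p.Bᵀ * Λ₁)
    + (p.HN N Λ₁ Λ₂ + ((N : ℝ) - 2) • p.EN N Λ₁ Λ₂) * p.Bᵀ * Λ₂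

/-- Θ₂^N. -/
noncomputable def Theta2N (N : ℕ) (Λ₁ Λ₂ : Matrix (Fin n) (Fin n) ℝ)
    (S : Matrix (Fin n) (Fin 1) ℝ) : Matrix (Fin n₁) (Fin 1) ℝ :=
  (p.HN N Λ₁ Λ₂ + ((N : ℝ) - 1) • p.EN N Λ₁ Λ₂) *
    (p.Bᵀ * S + p.B1ᵀ * Λ₁ * p.D + p.B0ᵀ * (Λ₁ + (1 - 1 / (N : ℝ)) • Λ₂) * p.D0)

/-- Z₀ = −B₀(Θ + Θ₁). -/
noncomputable def Z0 (Λ₁ Λ₂ : Matrix (Fin n) (Fin n) ℝ) : Matrix (Fin n) (Fin n) ℝ :=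
  -(p.B0 * (p.Theta Λ₁ + p.Theta1 Λ₁ Λ₂))

/-- Z₁ = A + G − B(Θ + Θ₁). -/
noncomputable def Z1 (Λ₁ Λ₂ : Matrix (Fin n) (Fin n) ℝ) : Matrix (Fin n) (Fin n) ℝ :=
  p.A + p.G - p.B * (p.Theta Λ₁ + p.Theta1 Λ₁ Λ₂)

/-! The high-dimensional equations under the decentralized control. -/

/-- RHS of (ODE-P̌₁) (paper's −d𝐏̌₁/dt). -/
noncomputable def Pcheck1RHS (N : ℕ) (Θ : Matrix (Fin n₁) (Fin n) ℝ)
    (P1 : Matrix (Fin N × Fin n) (Fin N × Fin n) ℝ) :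
    Matrix (Fin N × Fin n) (Fin N × Fin n) ℝ :=
  (kronIN N Θ)ᵀ * (p.bigR N + p.M2 N ((2 : ℝ) • P1)) * kronIN N Θ
    + P1 * (p.bigA N - p.bigBhat N * kronIN N Θ)
    + (p.bigA N - p.bigBhat N * kronIN N Θ)ᵀ * P1
    + p.bigQ N

/-- Solution of (ODE-P̌₁) on [0,T], with Θ(t) built from Λ₁(t). -/
noncomputable def IsSolPcheck1 (N : ℕ) (Λ₁ : ℝ → Matrix (Fin n) (Fin n) ℝ)
    (P1 : ℝ → Matrix (Fin N × Fin n) (Fin N × Fin n) ℝ) : Prop :=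
  P1 p.T = p.bigQf N ∧
  (∀ t ∈ Icc (0 : ℝ) p.T, ∀ x y, HasDerivWithinAt (fun s => P1 s x y)
    ((-(p.Pcheck1RHS N (p.Theta (Λ₁ t)) (P1 t))) x y) (Icc (0 : ℝ) p.T) t)

/-- RHS of (ODE-P̌₁₂) (paper's −d𝐏̌₁₂/dt). -/
noncomputable def Pcheck12RHS (N : ℕ) (Λ₁m Λ₂m : Matrix (Fin n) (Fin n) ℝ)
    (P1 : Matrix (Fin N × Fin n) (Fin N × Fin n) ℝ)
    (P12 : Matrix (Fin N × Fin n) (Fin n) ℝ) :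
    Matrix (Fin N × Fin n) (Fin n) ℝ :=
  (kronIN N (p.Theta Λ₁m))ᵀ * (p.bigR N + p.M2 N ((2 : ℝ) • P1)) *
      stackN N (p.Theta1 Λ₁m Λ₂m)
    - P1 * p.bigBhat N * stackN N (p.Theta1 Λ₁m Λ₂m)
    + ((p.bigA N)ᵀ - (kronIN N (p.Theta Λ₁m))ᵀ * (p.bigBhat N)ᵀ) * P12
    + P12 * p.Z1 Λ₁m Λ₂m
    - (kronIN N (p.Theta Λ₁m))ᵀ * (p.bigIhat N)ᵀ * (p.bigB0 N)ᵀ * P12 * p.Z0 Λ₁m Λ₂m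

/-- Solution of (ODE-P̌₁₂) on [0,T]. -/
noncomputable def IsSolPcheck12 (N : ℕ) (Λ₁ Λ₂ : ℝ → Matrix (Fin n) (Fin n) ℝ)
    (P1 : ℝ → Matrix (Fin N × Fin n) (Fin N × Fin n) ℝ)
    (P12 : ℝ → Matrix (Fin N × Fin n) (Fin n) ℝ) : Prop :=
  P12 p.T = 0 ∧
  (∀ t ∈ Icc (0 : ℝ) p.T, ∀ x y, HasDerivWithinAt (fun s => P12 s x y)
    ((-(p.Pcheck12RHS N (Λ₁ t) (Λ₂ t) (P1 t) (P12 t))) x y) (Icc (0 : ℝ) p.T) t)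

/-! The decentralized-control low-dimensional coefficient system. -/

/-- ǧ₁. -/
noncomputable def gc1 (N : ℕ) (Θ : Matrix (Fin n₁) (Fin n) ℝ)
    (L1 L2 : Matrix (Fin n) (Fin n) ℝ) : Matrix (Fin n) (Fin n) ℝ :=
  (1 / (N : ℝ)) •
    (Θᵀ * p.B0ᵀ * (L1 + (1 - 1 / (N : ℝ)) • L2) * p.B0 * Θ
      + (L1 + (1 - 1 / (N : ℝ)) • L2) * p.G
      + p.Gᵀ * (L1 + (1 - 1 / (N : ℝ)) • L2)
      + p.QΓ)

/-- ǧ₂. -/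
noncomputable def gc2 (N : ℕ) (Θ : Matrix (Fin n₁) (Fin n) ℝ)
    (L2 : Matrix (Fin n) (Fin n) ℝ) : Matrix (Fin n) (Fin n) ℝ :=
  -((1 / (N : ℝ)) • (Θᵀ * p.B0ᵀ * L2 * p.B0 * Θ + L2 * p.G + p.Gᵀ * L2))

/-- ǧ₁₂. -/
noncomputable def gc12 (N : ℕ) (Θ Θ₁ : Matrix (Fin n₁) (Fin n) ℝ)
    (L2 : Matrix (Fin n) (Fin n) ℝ) : Matrix (Fin n) (Fin n) ℝ :=
  (1 / (N : ℝ)) • (-(Θᵀ * p.B0ᵀ * L2 * p.B0 * Θ₁) + L2 * p.B * Θ₁)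

/-- ǧ₂₂. -/
noncomputable def gc22 (N : ℕ) (Θ₁ : Matrix (Fin n₁) (Fin n) ℝ)
    (L2 : Matrix (Fin n) (Fin n) ℝ) : Matrix (Fin n) (Fin n) ℝ :=
  -((1 / (N : ℝ)) • (Θ₁ᵀ * p.B0ᵀ * L2 * p.B0 * Θ₁))

/-- ǧ₀₁. -/
noncomputable def gc01 (N : ℕ) (Θ : Matrix (Fin n₁) (Fin n) ℝ)
    (Θ₂ : Matrix (Fin n₁) (Fin 1) ℝ) (L2 : Matrix (Fin n) (Fin n) ℝ) :
    Matrix (Fin n) (Fin 1) ℝ :=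
  (1 / (N : ℝ)) • (Θᵀ * p.B0ᵀ * L2 * (p.D0 - p.B0 * Θ₂) + L2 * p.B * Θ₂)

/-- ǧ₀₂. -/
noncomputable def gc02 (N : ℕ) (Θ₁ : Matrix (Fin n₁) (Fin n) ℝ)
    (Θ₂ : Matrix (Fin n₁) (Fin 1) ℝ) (L2 : Matrix (Fin n) (Fin n) ℝ) :
    Matrix (Fin n) (Fin 1) ℝ :=
  (1 / (N : ℝ)) • (-(Θ₁ᵀ * p.B0ᵀ * L2 * p.B0 * Θ₂) + Θ₁ᵀ * p.B0ᵀ * L2 * p.D0)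

/-- RHS of (ODE-Λ̌₁^N) (paper's −dΛ̌₁^N/dt). -/
noncomputable def check1RHS (N : ℕ) (Θ : Matrix (Fin n₁) (Fin n) ℝ)
    (L1 L2 : Matrix (Fin n) (Fin n) ℝ) : Matrix (Fin n) (Fin n) ℝ :=
  Θᵀ * p.R1 L1 * Θ + L1 * (p.A - p.B * Θ) + (p.A - p.B * Θ)ᵀ * L1 + p.Q
    + p.gc1 N Θ L1 L2

/-- RHS of (ODE-Λ̌₂^N). -/
noncomputable def check2RHS (N : ℕ) (Θ : Matrix (Fin n₁) (Fin n) ℝ)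
    (L1 L2 : Matrix (Fin n) (Fin n) ℝ) : Matrix (Fin n) (Fin n) ℝ :=
  Θᵀ * p.B0ᵀ * (L1 + L2) * p.B0 * Θ + L1 * p.G + p.Gᵀ * L1
    + L2 * (p.A + p.G - p.B * Θ) + (p.A + p.G - p.B * Θ)ᵀ * L2 + p.QΓ
    + p.gc2 N Θ L2

/-- RHS of (ODE-Λ̌₁₂^N). -/
noncomputable def check12RHS (N : ℕ) (Θ Θ₁ : Matrix (Fin n₁) (Fin n) ℝ)
    (L1 L2 L12 : Matrix (Fin n) (Fin n) ℝ) : Matrix (Fin n) (Fin n) ℝ :=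
  Θᵀ * p.R2 L1 L2 * Θ₁ + Θᵀ * p.B0ᵀ * L12 * p.B0 * (Θ + Θ₁)
    - (L1 + L2) * p.B * Θ₁
    + (p.A + p.G - p.B * Θ)ᵀ * L12
    + L12 * (p.A + p.G - p.B * (Θ₁ + Θ))
    + p.gc12 N Θ Θ₁ L2

/-- RHS of (ODE-Λ̌₂₂^N). -/
noncomputable def check22RHS (N : ℕ) (Θ₁ : Matrix (Fin n₁) (Fin n) ℝ)
    (Z₀ Z₁ : Matrix (Fin n) (Fin n) ℝ)
    (L1 L2 L12 L22 : Matrix (Fin n) (Fin n) ℝ) : Matrix (Fin n) (Fin n) ℝ :=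
  Θ₁ᵀ * p.R2 L1 L2 * Θ₁ - L12ᵀ * p.B * Θ₁ - Θ₁ᵀ * p.Bᵀ * L12
    + L22 * Z₁ + Z₁ᵀ * L22
    - Z₀ᵀ * L12ᵀ * p.B0 * Θ₁ - Θ₁ᵀ * p.B0ᵀ * L12 * Z₀
    + Z₀ᵀ * L22 * Z₀ + p.gc22 N Θ₁ L2

/-- RHS of (ODE-Š₁^N). -/
noncomputable def checkS1RHS (N : ℕ) (Θ : Matrix (Fin n₁) (Fin n) ℝ)
    (Θ₂ : Matrix (Fin n₁) (Fin 1) ℝ) (L1 L2 L12 : Matrix (Fin n) (Fin n) ℝ)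
    (S1 : Matrix (Fin n) (Fin 1) ℝ) : Matrix (Fin n) (Fin 1) ℝ :=
  Θᵀ * p.R2 L1 L2 * Θ₂ - (L1 + L2 + L12) * p.B * Θ₂
    - Θᵀ * (p.Bᵀ * S1 + p.B1ᵀ * L1 * p.D + p.B0ᵀ * (L1 + L2) * p.D0)
    - Θᵀ * p.B0ᵀ * L12 * (p.D0 - p.B0 * Θ₂)
    + (p.A + p.G)ᵀ * S1
    + p.gc01 N Θ Θ₂ L2

/-- RHS of (ODE-Š₂^N). -/
noncomputable def checkS2RHS (N : ℕ) (Θ₁ : Matrix (Fin n₁) (Fin n) ℝ)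
    (Θ₂ : Matrix (Fin n₁) (Fin 1) ℝ) (Z₀ Z₁ : Matrix (Fin n) (Fin n) ℝ)
    (L1 L2 L12 L22 : Matrix (Fin n) (Fin n) ℝ)
    (S1 S2 : Matrix (Fin n) (Fin 1) ℝ) : Matrix (Fin n) (Fin 1) ℝ :=
  Θ₁ᵀ * p.R2 L1 L2 * Θ₂ + Z₁ᵀ * S2
    - Θ₁ᵀ * (p.Bᵀ * S1 + p.B1ᵀ * L1 * p.D + p.B0ᵀ * (L1 + L2) * p.D0)
    + (Z₀ᵀ * L22 + Z₀ᵀ * L12ᵀ - Θ₁ᵀ * p.B0ᵀ * L12) * (p.D0 - p.B0 * Θ₂)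
    - (L12ᵀ + L22) * p.B * Θ₂
    + p.gc02 N Θ₁ Θ₂ L2

/-- Solution of the pair (ODE-Λ̌₁^N)–(ODE-Λ̌₂^N) on [0,T], with Θ(t) from the limiting Λ₁. -/
noncomputable def IsSolCheckA (N : ℕ) (Λ₁ : ℝ → Matrix (Fin n) (Fin n) ℝ)
    (L1 L2 : ℝ → Matrix (Fin n) (Fin n) ℝ) : Prop :=
  L1 p.T = p.Qf + (1 / (N : ℝ)) • p.QfΓ ∧ L2 p.T = p.QfΓ ∧
  (∀ t ∈ Icc (0 : ℝ) p.T, ∀ i j, HasDerivWithinAt (fun s => L1 s i j)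
    ((-(p.check1RHS N (p.Theta (Λ₁ t)) (L1 t) (L2 t))) i j) (Icc (0 : ℝ) p.T) t) ∧
  (∀ t ∈ Icc (0 : ℝ) p.T, ∀ i j, HasDerivWithinAt (fun s => L2 s i j)
    ((-(p.check2RHS N (p.Theta (Λ₁ t)) (L1 t) (L2 t))) i j) (Icc (0 : ℝ) p.T) t)

/-- Solution of (ODE-Λ̌₁^N)–(ODE-Λ̌₂₂^N) on [0,T], with Θ, Θ₁, Z₀, Z₁ from the limiting (Λ₁, Λ₂). -/
noncomputable def IsSolCheckB (N : ℕ) (Λ₁ Λ₂ : ℝ → Matrix (Fin n) (Fin n) ℝ)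
    (L1 L2 L12 L22 : ℝ → Matrix (Fin n) (Fin n) ℝ) : Prop :=
  p.IsSolCheckA N Λ₁ L1 L2 ∧
  L12 p.T = 0 ∧ L22 p.T = 0 ∧
  (∀ t ∈ Icc (0 : ℝ) p.T, ∀ i j, HasDerivWithinAt (fun s => L12 s i j)
    ((-(p.check12RHS N (p.Theta (Λ₁ t)) (p.Theta1 (Λ₁ t) (Λ₂ t))
        (L1 t) (L2 t) (L12 t))) i j) (Icc (0 : ℝ) p.T) t) ∧
  (∀ t ∈ Icc (0 : ℝ) p.T, ∀ i j, HasDerivWithinAt (fun s => L22 s i j)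
    ((-(p.check22RHS N (p.Theta1 (Λ₁ t) (Λ₂ t)) (p.Z0 (Λ₁ t) (Λ₂ t))
        (p.Z1 (Λ₁ t) (Λ₂ t)) (L1 t) (L2 t) (L12 t) (L22 t))) i j) (Icc (0 : ℝ) p.T) t)

/-- Solution of the full decentralized coefficient system on [0,T],
with Θ, Θ₁, Θ₂, Z₀, Z₁ from the limiting (Λ₁, Λ₂, S). -/
noncomputable def IsSolCheckC (N : ℕ) (Λ₁ Λ₂ : ℝ → Matrix (Fin n) (Fin n) ℝ)
    (S : ℝ → Matrix (Fin n) (Fin 1) ℝ)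
    (L1 L2 L12 L22 : ℝ → Matrix (Fin n) (Fin n) ℝ)
    (S1 S2 : ℝ → Matrix (Fin n) (Fin 1) ℝ) : Prop :=
  p.IsSolCheckB N Λ₁ Λ₂ L1 L2 L12 L22 ∧
  S1 p.T = 0 ∧ S2 p.T = 0 ∧
  (∀ t ∈ Icc (0 : ℝ) p.T, ∀ i j, HasDerivWithinAt (fun s => S1 s i j)
    ((-(p.checkS1RHS N (p.Theta (Λ₁ t)) (p.Theta2 (Λ₁ t) (Λ₂ t) (S t))
        (L1 t) (L2 t) (L12 t) (S1 t))) i j) (Icc (0 : ℝ) p.T) t) ∧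
  (∀ t ∈ Icc (0 : ℝ) p.T, ∀ i j, HasDerivWithinAt (fun s => S2 s i j)
    ((-(p.checkS2RHS N (p.Theta1 (Λ₁ t) (Λ₂ t)) (p.Theta2 (Λ₁ t) (Λ₂ t) (S t))
        (p.Z0 (Λ₁ t) (Λ₂ t)) (p.Z1 (Λ₁ t) (Λ₂ t))
        (L1 t) (L2 t) (L12 t) (L22 t) (S1 t) (S2 t))) i j) (Icc (0 : ℝ) p.T) t)

end Params

section

/-- Near a compact set of points where `F` is locally Lipschitz, increments of `F` based at points
of the set satisfy a Lipschitz bound with uniform constant and radius. -/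
lemma exists_uniform_lipschitz_near_compact {X Y : Type*} [PseudoMetricSpace X]
    [PseudoMetricSpace Y] {F : X → Y} {S : Set X} (hS : IsCompact S)
    (h : ∀ y ∈ S, ∃ K, ∃ U ∈ nhds y, LipschitzOnWith K F U) :
    ∃ K : ℝ, 0 ≤ K ∧ ∃ δ : ℝ, 0 < δ ∧
      ∀ y ∈ S, ∀ z, dist z y < δ → dist (F z) (F y) ≤ K * dist z y := by
  refine hS.induction_on ⟨0, le_rfl, 1, one_pos, by simp⟩ ?_ ?_ ?_
  · rintro s t hst ⟨K, hK, δ, hδ, H⟩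
    exact ⟨K, hK, δ, hδ, fun y hy => H y (hst hy)⟩
  · rintro s t ⟨K, hK, δ, hδ, H⟩ ⟨K', hK', δ', hδ', H'⟩
    refine ⟨max K K', le_max_of_le_left hK, min δ δ', lt_min hδ hδ', ?_⟩
    rintro y (hy | hy) z hz
    · exact (H y hy z (hz.trans_le (min_le_left _ _))).trans
        (mul_le_mul_of_nonneg_right (le_max_left _ _) dist_nonneg)
    · exact (H' y hy z (hz.trans_le (min_le_right _ _))).trans
        (mul_le_mul_of_nonneg_right (le_max_right _ _) dist_nonneg)
  · intro y hy
    obtain ⟨K, U, hU, hF⟩ := h y hy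
    obtain ⟨r, hr, hrU⟩ := Metric.mem_nhds_iff.1 hU
    refine ⟨Metric.ball y (r / 2), mem_nhdsWithin_of_mem_nhds (Metric.ball_mem_nhds y (half_pos hr)),
      K, K.coe_nonneg, r / 2, half_pos hr, fun x hx z hz => ?_⟩
    have hx' : dist x y < r / 2 := hx
    refine hF.dist_le_mul z (hrU ?_) x (hrU ?_)
    · exact Metric.mem_ball.2 (by linarith [dist_triangle z x y])
    · exact Metric.mem_ball.2 (by linarith)

/-- Backward Grönwall estimate from a terminal value; the derivative bound is only required inside
the region described by the conclusion. -/
lemma norm_le_of_norm_deriv_le_backward {E : Type*} [NormedAddCommGroup E] [NormedSpace ℝ E]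
    {T K b : ℝ} (hK : 0 ≤ K) (hb : 0 < b) {f f' : ℝ → E}
    (hf : ∀ t ∈ Icc 0 T, HasDerivWithinAt f (f' t) (Icc 0 T) t) (hfT : ‖f T‖ ≤ b)
    (hbound : ∀ t ∈ Icc 0 T, ‖f t‖ ≤ b * Real.exp ((2 * K + 1) * T) →
      ‖f' t‖ ≤ K * (b + ‖f t‖)) :
    ∀ t ∈ Icc 0 T, ‖f t‖ ≤ b * Real.exp ((2 * K + 1) * T) := by
  have hmaps : MapsTo (fun s => T - s) (Icc 0 T) (Icc 0 T) := fun s hs =>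
    ⟨by linarith [hs.2], by linarith [hs.1]⟩
  have hrev : ∀ s ∈ Icc 0 T,
      HasDerivWithinAt (fun s => f (T - s)) (-f' (T - s)) (Icc 0 T) s := by
    intro s hs
    have h := (hf (T - s) (hmaps hs)).scomp s
      (((hasDerivAt_id s).const_sub T).hasDerivWithinAt) hmaps
    simpa [Function.comp_def] using h
  have hB : ∀ s, HasDerivAt (fun s => b * Real.exp ((2 * K + 1) * s))
      (b * (Real.exp ((2 * K + 1) * s) * (2 * K + 1))) s := by
    intro s
    have h := ((hasDerivAt_id s).const_mul (2 * K + 1)).exp.const_mul b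
    simpa using h
  have hfence := image_norm_le_of_norm_deriv_right_lt_deriv_boundary
    (fun s hs => (hrev s hs).continuousWithinAt)
    (fun s hs => (hrev s (Ico_subset_Icc_self hs)).mono_of_mem_nhdsWithin
      (Icc_mem_nhdsGE_of_mem hs))
    (by simpa using hfT) hB (fun s hs heq => by
      have hmono : Real.exp ((2 * K + 1) * s) ≤ Real.exp ((2 * K + 1) * T) :=
        Real.exp_le_exp.2 (mul_le_mul_of_nonneg_left hs.2.le (by linarith))
      have hone : 1 ≤ Real.exp ((2 * K + 1) * s) :=
        Real.one_le_exp (mul_nonneg (by linarith) hs.1)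
      have h := hbound (T - s) (hmaps (Ico_subset_Icc_self hs))
        (heq.le.trans (mul_le_mul_of_nonneg_left hmono hb.le))
      rw [heq] at h
      rw [norm_neg]
      have h1 : b ≤ b * Real.exp ((2 * K + 1) * s) := le_mul_of_one_le_right hb.le hone
      have h2 := mul_le_mul_of_nonneg_left h1 hK
      nlinarith)
  intro t ht
  have h := hfence (hmaps ht)
  simp only [sub_sub_cancel] at h
  refine h.trans (mul_le_mul_of_nonneg_left (Real.exp_le_exp.2 ?_) hb.le)
  exact mul_le_mul_of_nonneg_left (hmaps ht).2 (by linarith)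

/-- A solution on `[0, T]` of an ODE depending smoothly on a small parameter `ε` stays `O(ε)`-close
to a given solution for `ε = 0`, as soon as the terminal values are `O(ε)`-close. -/
lemma exists_dist_le_of_smooth_perturbation {P E : Type*} [NormedAddCommGroup P] [NormedSpace ℝ P]
    [NormedAddCommGroup E] [NormedSpace ℝ E] {T : ℝ} (hT : 0 ≤ T)
    {F : P × ℝ × E → E} {θ : ℝ → P} {y : ℝ → E}
    (hθ : ContinuousOn θ (Icc 0 T))
    (hF : ∀ t ∈ Icc 0 T, ContDiffAt ℝ 1 F (θ t, 0, y t))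
    (hy : ∀ t ∈ Icc 0 T, HasDerivWithinAt y (F (θ t, 0, y t)) (Icc 0 T) t) (c : ℝ) :
    ∃ ε₀ : ℝ, 0 < ε₀ ∧ ∃ C : ℝ, 0 < C ∧ ∀ ε : ℝ, 0 < ε → ε < ε₀ → ∀ x : ℝ → E,
      (∀ t ∈ Icc 0 T, HasDerivWithinAt x (F (θ t, ε, x t)) (Icc 0 T) t) →
      ‖x T - y T‖ ≤ c * ε → ∀ t ∈ Icc 0 T, ‖x t - y t‖ ≤ C * ε := by
  have hycont : ContinuousOn y (Icc 0 T) := fun t ht => (hy t ht).continuousWithinAt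
  have hcomp : IsCompact ((fun t => (θ t, (0 : ℝ), y t)) '' Icc 0 T) :=
    isCompact_Icc.image_of_continuousOn (hθ.prodMk (continuousOn_const.prodMk hycont))
  obtain ⟨K, hK, δ, hδ, H⟩ := exists_uniform_lipschitz_near_compact (F := F) hcomp (by
    rintro _ ⟨t, ht, rfl⟩
    exact (hF t ht).exists_lipschitzOnWith)
  set M := Real.exp ((2 * K + 1) * T) with hM
  have hM1 : 1 ≤ M := Real.one_le_exp (mul_nonneg (by linarith) hT)
  have hc : 1 ≤ 1 + |c| := by linarith [abs_nonneg c]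
  have hC : 1 ≤ (1 + |c|) * M := by nlinarith
  refine ⟨δ / ((1 + |c|) * M), by positivity, (1 + |c|) * M, by positivity, ?_⟩
  intro ε hε hεlt x hx hxT
  rw [lt_div_iff₀ (by positivity)] at hεlt
  have hle : ε ≤ (1 + |c|) * ε := le_mul_of_one_le_left hε.le hc
  have key := norm_le_of_norm_deriv_le_backward (b := (1 + |c|) * ε) hK (by positivity)
    (fun t ht => (hx t ht).sub (hy t ht))
    (show ‖x T - y T‖ ≤ _ from hxT.trans (mul_le_mul_of_nonneg_right
      (by linarith [le_abs_self c]) hε.le))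
    (fun t ht hbd => by
      have hdist : dist (θ t, ε, x t) (θ t, (0 : ℝ), y t) = max ε ‖x t - y t‖ := by
        simp [dist_eq_norm, abs_of_pos hε, hε.le]
      have hnear : max ε ‖x t - y t‖ < δ := by
        refine max_lt ?_ ?_
        · nlinarith
        · refine lt_of_le_of_lt hbd ?_
          calc (1 + |c|) * ε * M = ε * ((1 + |c|) * M) := by ring
            _ < δ := hεlt
      have h := H _ ⟨t, ht, rfl⟩ (θ t, ε, x t) (by rw [hdist]; exact hnear)
      rw [hdist, dist_eq_norm] at h
      refine h.trans (mul_le_mul_of_nonneg_left (max_le ?_ ?_) hK)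
      · exact hle.trans (le_add_of_nonneg_right (norm_nonneg _))
      · exact le_add_of_nonneg_left (by positivity))
  intro t ht
  calc ‖x t - y t‖ ≤ (1 + |c|) * ε * M := key t ht
    _ = (1 + |c|) * M * ε := by ring

end


section

attribute [local instance] Matrix.normedAddCommGroup Matrix.normedSpace

variable {X : Type*} [NormedAddCommGroup X] [NormedSpace ℝ X] {x : X}
  {a b c : ℕ}

lemma contDiffAt_matrix_iff {f : X → Matrix (Fin a) (Fin b) ℝ} :
    ContDiffAt ℝ 1 f x ↔ ∀ i j, ContDiffAt ℝ 1 (fun y => f y i j) x :=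
  contDiffAt_pi.trans (forall_congr' fun _ => contDiffAt_pi)

lemma hasDerivWithinAt_matrix_iff {f : ℝ → Matrix (Fin a) (Fin b) ℝ}
    {f' : Matrix (Fin a) (Fin b) ℝ} {s : Set ℝ} {t : ℝ} :
    HasDerivWithinAt f f' s t ↔ ∀ i j, HasDerivWithinAt (fun y => f y i j) (f' i j) s t :=
  hasDerivWithinAt_pi.trans (forall_congr' fun _ => hasDerivWithinAt_pi)

@[fun_prop]
lemma contDiffAt_matrix_mul {f : X → Matrix (Fin a) (Fin b) ℝ} {g : X → Matrix (Fin b) (Fin c) ℝ}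
    (hf : ContDiffAt ℝ 1 f x) (hg : ContDiffAt ℝ 1 g x) :
    ContDiffAt ℝ 1 (fun y => f y * g y) x := by
  rw [contDiffAt_matrix_iff] at *
  intro i j
  simp only [Matrix.mul_apply]
  exact ContDiffAt.sum fun k _ => (hf i k).mul (hg k j)

@[fun_prop]
lemma contDiffAt_matrix_transpose {f : X → Matrix (Fin a) (Fin b) ℝ}
    (hf : ContDiffAt ℝ 1 f x) : ContDiffAt ℝ 1 (fun y => (f y)ᵀ) x := by
  rw [contDiffAt_matrix_iff] at *
  exact fun i j => hf j i

lemma contDiffAt_matrix_det {f : X → Matrix (Fin a) (Fin a) ℝ}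
    (hf : ContDiffAt ℝ 1 f x) : ContDiffAt ℝ 1 (fun y => (f y).det) x := by
  rw [contDiffAt_matrix_iff] at hf
  simp only [Matrix.det_apply]
  exact ContDiffAt.sum fun σ _ => (contDiffAt_prod fun i _ => hf (σ i) i).const_smul _

lemma contDiffAt_matrix_inv {f : X → Matrix (Fin a) (Fin a) ℝ}
    (hf : ContDiffAt ℝ 1 f x) (hx : (f x).det ≠ 0) :
    ContDiffAt ℝ 1 (fun y => (f y)⁻¹) x := by
  have hf' := contDiffAt_matrix_iff.1 hf
  rw [contDiffAt_matrix_iff]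
  intro i j
  simp only [Matrix.inv_def, Ring.inverse_eq_inv', Matrix.smul_apply, smul_eq_mul,
    Matrix.adjugate_apply]
  refine ((contDiffAt_matrix_det hf).inv hx).mul (contDiffAt_matrix_det ?_)
  rw [contDiffAt_matrix_iff]
  intro k l
  by_cases hk : k = j
  · subst hk
    simpa using contDiffAt_const
  · simpa [Matrix.updateRow_ne hk] using hf' k l

namespace Params

variable {n n₁ : ℕ} (p : Params n n₁)

/-- The matrix `N • E^N`, as a function of `ε = 1 / N`. -/
noncomputable def scaledE (ε : ℝ) (Λ₁ Λ₂ : Matrix (Fin n) (Fin n) ℝ) :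
    Matrix (Fin n₁) (Fin n₁) ℝ :=
  (p.R2 Λ₁ Λ₂ - ε • (p.B0ᵀ * Λ₂ * p.B0))⁻¹ - (p.R1 Λ₁)⁻¹

/-- The perturbation `g₁` as a function of `ε = 1 / N`, extended to `ε = 0`. -/
noncomputable def g₁Eps (ε : ℝ) (Λ₁ Λ₂ : Matrix (Fin n) (Fin n) ℝ) :
    Matrix (Fin n) (Fin n) ℝ :=
  Λ₁ * p.B * (ε • p.scaledE ε Λ₁ Λ₂) * p.Bᵀ * Λ₁
  + (1 - ε) • (Λ₂ * p.B * (ε • p.scaledE ε Λ₁ Λ₂) * p.Bᵀ * Λ₁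
      + Λ₁ * p.B * (ε • p.scaledE ε Λ₁ Λ₂) * p.Bᵀ * Λ₂)
  + (ε - ε ^ 2) • (Λ₂ * p.B * (ε • p.scaledE ε Λ₁ Λ₂ + (p.R1 Λ₁)⁻¹
      + (1 - 2 * ε) • p.scaledE ε Λ₁ Λ₂) * p.Bᵀ * Λ₂)
  - ε • ((Λ₁ * p.G + p.Gᵀ * Λ₁) + (1 - ε) • (Λ₂ * p.G + p.Gᵀ * Λ₂))
  - ε • p.QΓ

/-- The perturbation `g₂` as a function of `ε = 1 / N`, extended to `ε = 0`. -/
noncomputable def g₂Eps (ε : ℝ) (Λ₁ Λ₂ : Matrix (Fin n) (Fin n) ℝ) :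
    Matrix (Fin n) (Fin n) ℝ :=
  (Λ₁ + Λ₂) * p.B * (p.scaledE ε Λ₁ Λ₂ + (p.R1 Λ₁)⁻¹ - (p.R2 Λ₁ Λ₂)⁻¹) * p.Bᵀ * (Λ₁ + Λ₂)
  - (2 * ε) • (Λ₂ * p.B * (p.R1 Λ₁)⁻¹ * p.Bᵀ * Λ₂)
  + (ε - 2) • (Λ₂ * p.B * (ε • p.scaledE ε Λ₁ Λ₂) * p.Bᵀ * Λ₂)
  - Λ₁ * p.B * (ε • p.scaledE ε Λ₁ Λ₂) * p.Bᵀ * Λ₂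
  - Λ₂ * p.B * (ε • p.scaledE ε Λ₁ Λ₂) * p.Bᵀ * Λ₁
  + ε • (Λ₂ * p.G + p.Gᵀ * Λ₂)

lemma EN_eq_smul_scaledE (N : ℕ) (Λ₁ Λ₂ : Matrix (Fin n) (Fin n) ℝ) :
    p.EN N Λ₁ Λ₂ = (1 / (N : ℝ)) • p.scaledE (1 / (N : ℝ)) Λ₁ Λ₂ := rfl

lemma g₁_eq_g₁Eps {N : ℕ} (hN : 1 ≤ N) (Λ₁ Λ₂ : Matrix (Fin n) (Fin n) ℝ) :
    p.g₁ N Λ₁ Λ₂ = p.g₁Eps (1 / (N : ℝ)) Λ₁ Λ₂ := by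
  have hN' : (N : ℝ) ≠ 0 := by positivity
  have h : ((N : ℝ) - 2) * (1 / (N : ℝ)) = 1 - 2 * (1 / (N : ℝ)) := by field_simp
  simp only [g₁, g₁Eps, HN, EN_eq_smul_scaledE, smul_smul, h, _root_.one_div_pow]

lemma g₂_eq_g₂Eps {N : ℕ} (hN : 1 ≤ N) (Λ₁ Λ₂ : Matrix (Fin n) (Fin n) ℝ) :
    p.g₂ N Λ₁ Λ₂ = p.g₂Eps (1 / (N : ℝ)) Λ₁ Λ₂ := by
  have hN' : (N : ℝ) ≠ 0 := by positivity
  have h : (N : ℝ) * (1 / (N : ℝ)) = 1 := by field_simp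
  have h2 : 2 / (N : ℝ) = 2 * (1 / (N : ℝ)) := by ring
  simp only [g₂, g₂Eps, EN_eq_smul_scaledE, smul_smul, h, h2, one_smul]

lemma g₁Eps_zero (Λ₁ Λ₂ : Matrix (Fin n) (Fin n) ℝ) : p.g₁Eps 0 Λ₁ Λ₂ = 0 := by
  simp [g₁Eps]

lemma g₂Eps_zero (Λ₁ Λ₂ : Matrix (Fin n) (Fin n) ℝ) : p.g₂Eps 0 Λ₁ Λ₂ = 0 := by
  simp [g₂Eps, scaledE]

/-- Right-hand side of the system for `(Λ̌₁, ε • Λ̌₂)`, first component. -/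
noncomputable def checkField₁ (Θ : Matrix (Fin n₁) (Fin n) ℝ) (ε : ℝ)
    (L Z : Matrix (Fin n) (Fin n) ℝ) : Matrix (Fin n) (Fin n) ℝ :=
  -(Θᵀ * p.R1 L * Θ + L * (p.A - p.B * Θ) + (p.A - p.B * Θ)ᵀ * L + p.Q
    + (Θᵀ * p.B0ᵀ * (ε • L + (1 - ε) • Z) * p.B0 * Θ + (ε • L + (1 - ε) • Z) * p.G
      + p.Gᵀ * (ε • L + (1 - ε) • Z) + ε • p.QΓ))

/-- Right-hand side of the system for `(Λ̌₁, ε • Λ̌₂)`, second component. -/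
noncomputable def checkField₂ (Θ : Matrix (Fin n₁) (Fin n) ℝ) (ε : ℝ)
    (L Z : Matrix (Fin n) (Fin n) ℝ) : Matrix (Fin n) (Fin n) ℝ :=
  -(Θᵀ * p.B0ᵀ * (ε • L + Z) * p.B0 * Θ + ε • (L * p.G) + ε • (p.Gᵀ * L)
    + Z * (p.A + p.G - p.B * Θ) + (p.A + p.G - p.B * Θ)ᵀ * Z + ε • p.QΓ
    - ε • (Θᵀ * p.B0ᵀ * Z * p.B0 * Θ + Z * p.G + p.Gᵀ * Z))

lemma neg_check1RHS_eq (N : ℕ) (Θ : Matrix (Fin n₁) (Fin n) ℝ)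
    (L1 L2 : Matrix (Fin n) (Fin n) ℝ) :
    -p.check1RHS N Θ L1 L2 = p.checkField₁ Θ (1 / (N : ℝ)) L1 ((1 / (N : ℝ)) • L2) := by
  simp only [check1RHS, checkField₁, gc1, Matrix.mul_add, Matrix.add_mul, Matrix.mul_smul,
    Matrix.smul_mul]
  module

lemma smul_neg_check2RHS_eq (N : ℕ) (Θ : Matrix (Fin n₁) (Fin n) ℝ)
    (L1 L2 : Matrix (Fin n) (Fin n) ℝ) :
    (1 / (N : ℝ)) • -p.check2RHS N Θ L1 L2
      = p.checkField₂ Θ (1 / (N : ℝ)) L1 ((1 / (N : ℝ)) • L2) := by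
  simp only [check2RHS, checkField₂, gc2, Matrix.mul_add, Matrix.add_mul, Matrix.mul_smul,
    Matrix.smul_mul]
  module

lemma checkField₁_Theta {Λ : Matrix (Fin n) (Fin n) ℝ} (hΛ : Λ.IsSymm) (hR : (p.R1 Λ).PosDef) :
    p.checkField₁ (p.Theta Λ) 0 Λ 0 = p.Ψ₁ Λ := by
  have hdet : IsUnit (p.R1 Λ).det := hR.det_pos.ne'.isUnit
  have hRT : (p.R1 Λ)ᵀ = p.R1 Λ := by simpa using hR.isHermitian.eq
  have hΘ : (p.Theta Λ)ᵀ = Λ * p.B * (p.R1 Λ)⁻¹ := by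
    simp [Theta, Matrix.transpose_mul, Matrix.transpose_nonsing_inv, hRT, hΛ.eq, Matrix.mul_assoc]
  have hmid : (p.Theta Λ)ᵀ * p.R1 Λ * p.Theta Λ = Λ * p.B * (p.R1 Λ)⁻¹ * p.Bᵀ * Λ := by
    rw [hΘ, Matrix.nonsing_inv_mul_cancel_right _ _ hdet, Theta]
    simp only [Matrix.mul_assoc]
  have hleft : Λ * (p.B * p.Theta Λ) = Λ * p.B * (p.R1 Λ)⁻¹ * p.Bᵀ * Λ := by
    simp only [Theta, Matrix.mul_assoc]
  have hright : (p.Theta Λ)ᵀ * p.Bᵀ * Λ = Λ * p.B * (p.R1 Λ)⁻¹ * p.Bᵀ * Λ := by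
    rw [hΘ]
  simp only [checkField₁, hmid, Matrix.mul_sub, Matrix.transpose_sub, Matrix.transpose_mul,
    Matrix.sub_mul, hleft, hright, zero_smul, smul_zero, add_zero, Matrix.mul_zero,
    Matrix.zero_mul, Ψ₁]
  abel

lemma checkField₂_zero (Θ : Matrix (Fin n₁) (Fin n) ℝ) (L : Matrix (Fin n) (Fin n) ℝ) :
    p.checkField₂ Θ 0 L 0 = 0 := by
  simp [checkField₂]

lemma contDiffAt_R1_inv {f : X → Matrix (Fin n) (Fin n) ℝ} (hf : ContDiffAt ℝ 1 f x)
    (hR : (p.R1 (f x)).PosDef) : ContDiffAt ℝ 1 (fun y => (p.R1 (f y))⁻¹) x := by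
  refine contDiffAt_matrix_inv ?_ hR.det_pos.ne'
  unfold R1
  fun_prop

lemma contDiffAt_R2_inv {f g : X → Matrix (Fin n) (Fin n) ℝ} (hf : ContDiffAt ℝ 1 f x)
    (hg : ContDiffAt ℝ 1 g x) (hR : (p.R2 (f x) (g x)).PosDef) :
    ContDiffAt ℝ 1 (fun y => (p.R2 (f y) (g y))⁻¹) x := by
  refine contDiffAt_matrix_inv ?_ hR.det_pos.ne'
  unfold R2
  fun_prop

lemma contDiffAt_scaledE {e : X → ℝ} {f g : X → Matrix (Fin n) (Fin n) ℝ}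
    (he : ContDiffAt ℝ 1 e x) (hf : ContDiffAt ℝ 1 f x) (hg : ContDiffAt ℝ 1 g x)
    (he0 : e x = 0) (hR1 : (p.R1 (f x)).PosDef) (hR2 : (p.R2 (f x) (g x)).PosDef) :
    ContDiffAt ℝ 1 (fun y => p.scaledE (e y) (f y) (g y)) x := by
  unfold scaledE
  refine (contDiffAt_matrix_inv ?_ ?_).sub (p.contDiffAt_R1_inv hf hR1)
  · unfold R2
    fun_prop
  · simpa [he0] using hR2.det_pos.ne'

lemma contDiffAt_rescaled_fields {e : X → ℝ} {f g : X → Matrix (Fin n) (Fin n) ℝ}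
    (he : ContDiffAt ℝ 1 e x) (hf : ContDiffAt ℝ 1 f x) (hg : ContDiffAt ℝ 1 g x)
    (he0 : e x = 0) (hR1 : (p.R1 (f x)).PosDef) (hR2 : (p.R2 (f x) (g x)).PosDef) :
    ContDiffAt ℝ 1 (fun y => (p.Ψ₁ (f y) + p.g₁Eps (e y) (f y) (g y),
      p.Ψ₂ (f y) (g y) + p.g₂Eps (e y) (f y) (g y))) x := by
  have h1 := p.contDiffAt_R1_inv hf hR1
  have h2 := p.contDiffAt_R2_inv hf hg hR2
  have h3 := p.contDiffAt_scaledE he hf hg he0 hR1 hR2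
  unfold Ψ₁ Ψ₂ g₁Eps g₂Eps
  refine ContDiffAt.prodMk ?_ ?_ <;> fun_prop

lemma contDiffAt_check_fields {e : X → ℝ} {h : X → Matrix (Fin n₁) (Fin n) ℝ}
    {f g : X → Matrix (Fin n) (Fin n) ℝ} (he : ContDiffAt ℝ 1 e x) (hh : ContDiffAt ℝ 1 h x)
    (hf : ContDiffAt ℝ 1 f x) (hg : ContDiffAt ℝ 1 g x) :
    ContDiffAt ℝ 1 (fun y => (p.checkField₁ (h y) (e y) (f y) (g y),
      p.checkField₂ (h y) (e y) (f y) (g y))) x := by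
  unfold checkField₁ checkField₂ R1
  refine ContDiffAt.prodMk ?_ ?_ <;> fun_prop

variable {p} {Λ₁ Λ₂ : ℝ → Matrix (Fin n) (Fin n) ℝ}

lemma IsSolLim.hasDerivWithinAt_fst (h : p.IsSolLim Λ₁ Λ₂) {t : ℝ} (ht : t ∈ Icc 0 p.T) :
    HasDerivWithinAt Λ₁ (p.Ψ₁ (Λ₁ t)) (Icc 0 p.T) t :=
  hasDerivWithinAt_matrix_iff.2 (h.2.2.2.2.1 t ht)

lemma IsSolLim.hasDerivWithinAt_snd (h : p.IsSolLim Λ₁ Λ₂) {t : ℝ} (ht : t ∈ Icc 0 p.T) :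
    HasDerivWithinAt Λ₂ (p.Ψ₂ (Λ₁ t) (Λ₂ t)) (Icc 0 p.T) t :=
  hasDerivWithinAt_matrix_iff.2 (h.2.2.2.2.2 t ht)

lemma IsSolLim.continuousOn_Theta (h : p.IsSolLim Λ₁ Λ₂) :
    ContinuousOn (fun t => p.Theta (Λ₁ t)) (Icc 0 p.T) := by
  intro t ht
  have hΘ : ContDiffAt ℝ 1 p.Theta (Λ₁ t) := by
    have hR := p.contDiffAt_R1_inv (f := fun Λ => Λ) contDiffAt_id (h.2.1 t ht).1
    unfold Theta
    fun_prop
  exact hΘ.continuousAt.comp_continuousWithinAt (h.hasDerivWithinAt_fst ht).continuousWithinAt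

lemma exists_norm_rescaled_sub_le (hT : 0 ≤ p.T) (hLim : p.IsSolLim Λ₁ Λ₂) :
    ∃ ε₀ : ℝ, 0 < ε₀ ∧ ∃ C : ℝ, 0 < C ∧ ∀ N : ℕ, 1 ≤ N → 1 / (N : ℝ) < ε₀ →
      ∀ Λ₁N Λ₂N : ℝ → Matrix (Fin n) (Fin n) ℝ, p.IsSolLamN N Λ₁N Λ₂N →
        ∀ t ∈ Icc 0 p.T, ‖Λ₁N t - Λ₁ t‖ ≤ C * (1 / (N : ℝ)) := by
  obtain ⟨ε₀, hε₀, C, hC, H⟩ := exists_dist_le_of_smooth_perturbation hT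
    (F := fun v : ℝ × ℝ × (Matrix (Fin n) (Fin n) ℝ × Matrix (Fin n) (Fin n) ℝ) =>
      (p.Ψ₁ v.2.2.1 + p.g₁Eps v.2.1 v.2.2.1 v.2.2.2,
        p.Ψ₂ v.2.2.1 v.2.2.2 + p.g₂Eps v.2.1 v.2.2.1 v.2.2.2))
    (θ := fun _ => 0) (y := fun t => (Λ₁ t, Λ₂ t)) continuousOn_const
    (fun t ht => p.contDiffAt_rescaled_fields (by fun_prop) (by fun_prop) (by fun_prop) rfl
      (hLim.2.1 t ht).1 (hLim.2.1 t ht).2)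
    (fun t ht => by
      simpa only [g₁Eps_zero, g₂Eps_zero, add_zero] using
        (hLim.hasDerivWithinAt_fst ht).prodMk (hLim.hasDerivWithinAt_snd ht))
    ‖p.QfΓ‖
  refine ⟨ε₀, hε₀, C, hC, fun N hN hNε Λ₁N Λ₂N hsol t ht => ?_⟩
  have hpos : 0 < 1 / (N : ℝ) := by positivity
  refine (norm_fst_le _).trans (H (1 / (N : ℝ)) hpos hNε (fun t => (Λ₁N t, Λ₂N t)) ?_ ?_ t ht)
  · intro t ht
    simp only [← g₁_eq_g₁Eps p hN, ← g₂_eq_g₂Eps p hN]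
    exact (hasDerivWithinAt_matrix_iff.2 (hsol.2.2.2.2.1 t ht)).prodMk
      (hasDerivWithinAt_matrix_iff.2 (hsol.2.2.2.2.2 t ht))
  · have h1 : Λ₁N p.T - Λ₁ p.T = (1 / (N : ℝ)) • p.QfΓ := by
      rw [hsol.2.2.1, hLim.2.2.1, add_sub_cancel_left]
    have h2 : Λ₂N p.T - Λ₂ p.T = 0 := by
      rw [hsol.2.2.2.1, hLim.2.2.2.1, sub_self]
    rw [Prod.mk_sub_mk, h1, h2, Prod.norm_mk, norm_zero, norm_smul, Real.norm_of_nonneg hpos.le,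
      mul_comm]
    exact max_le le_rfl (by positivity)

lemma exists_norm_check_sub_le (hT : 0 ≤ p.T) (hLim : p.IsSolLim Λ₁ Λ₂) :
    ∃ ε₀ : ℝ, 0 < ε₀ ∧ ∃ C : ℝ, 0 < C ∧ ∀ N : ℕ, 1 ≤ N → 1 / (N : ℝ) < ε₀ →
      ∀ L1 L2 : ℝ → Matrix (Fin n) (Fin n) ℝ, p.IsSolCheckA N Λ₁ L1 L2 →
        ∀ t ∈ Icc 0 p.T, ‖L1 t - Λ₁ t‖ ≤ C * (1 / (N : ℝ)) := by
  obtain ⟨ε₀, hε₀, C, hC, H⟩ := exists_dist_le_of_smooth_perturbation hT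
    (F := fun v : Matrix (Fin n₁) (Fin n) ℝ × ℝ ×
        (Matrix (Fin n) (Fin n) ℝ × Matrix (Fin n) (Fin n) ℝ) =>
      (p.checkField₁ v.1 v.2.1 v.2.2.1 v.2.2.2, p.checkField₂ v.1 v.2.1 v.2.2.1 v.2.2.2))
    (θ := fun t => p.Theta (Λ₁ t)) (y := fun t => (Λ₁ t, 0)) hLim.continuousOn_Theta
    (fun t ht => p.contDiffAt_check_fields (by fun_prop) (by fun_prop) (by fun_prop) (by fun_prop))
    (fun t ht => by
      simpa only [p.checkField₁_Theta (hLim.1 t ht).1 (hLim.2.1 t ht).1, checkField₂_zero] using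
        (hLim.hasDerivWithinAt_fst ht).prodMk (hasDerivWithinAt_const _ _ _))
    ‖p.QfΓ‖
  refine ⟨ε₀, hε₀, C, hC, fun N hN hNε L1 L2 hsol t ht => ?_⟩
  have hpos : 0 < 1 / (N : ℝ) := by positivity
  refine (norm_fst_le _).trans
    (H (1 / (N : ℝ)) hpos hNε (fun t => (L1 t, (1 / (N : ℝ)) • L2 t)) ?_ ?_ t ht)
  · intro t ht
    simp only [← neg_check1RHS_eq, ← smul_neg_check2RHS_eq]
    exact (hasDerivWithinAt_matrix_iff.2 (hsol.2.2.1 t ht)).prodMk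
      ((hasDerivWithinAt_matrix_iff.2 (hsol.2.2.2 t ht)).const_smul (1 / (N : ℝ)))
  · have h1 : L1 p.T - Λ₁ p.T = (1 / (N : ℝ)) • p.QfΓ := by
      rw [hsol.1, hLim.2.2.1, add_sub_cancel_left]
    rw [Prod.mk_sub_mk, h1, hsol.2.1, sub_zero, Prod.norm_mk, norm_smul,
      Real.norm_of_nonneg hpos.le, mul_comm, max_self]

/-- Entrywise form of the `O(1/N)` estimate between `Λ̌₁^N` and `Λ₁^N`. -/
lemma exists_entry_check_sub_rescaled_le (hT : 0 ≤ p.T) (hLim : p.IsSolLim Λ₁ Λ₂) :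
    ∃ N₁ : ℕ, 1 ≤ N₁ ∧ ∃ C : ℝ, 0 < C ∧ ∀ N : ℕ, N₁ ≤ N →
      ∀ L1 L2 Λ₁N Λ₂N : ℝ → Matrix (Fin n) (Fin n) ℝ,
        p.IsSolCheckA N Λ₁ L1 L2 → p.IsSolLamN N Λ₁N Λ₂N →
        ∀ t ∈ Icc 0 p.T, ∀ i j, |L1 t i j - Λ₁N t i j| ≤ C / (N : ℝ) := by
  obtain ⟨ε, hε, C, hC, H⟩ := exists_norm_check_sub_le hT hLim
  obtain ⟨ε', hε', C', hC', H'⟩ := exists_norm_rescaled_sub_le hT hLim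
  obtain ⟨m, hm⟩ := exists_nat_one_div_lt (lt_min hε hε')
  refine ⟨m + 1, by omega, C + C', by positivity,
    fun N hN L1 L2 Λ₁N Λ₂N hL hN' t ht i j => ?_⟩
  have hN1 : 1 ≤ N := by omega
  have hlt : 1 / (N : ℝ) < min ε ε' :=
    (one_div_le_one_div_of_le (by positivity) (by exact_mod_cast hN)).trans_lt hm
  have h := H N hN1 (hlt.trans_le (min_le_left _ _)) L1 L2 hL t ht
  have h' := H' N hN1 (hlt.trans_le (min_le_right _ _)) Λ₁N Λ₂N hN' t ht
  have he := (Matrix.norm_entry_le_entrywise_sup_norm (L1 t - Λ₁N t) (i := i) (j := j)).trans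
    (norm_sub_le_norm_sub_add_norm_sub (L1 t) (Λ₁ t) (Λ₁N t))
  rw [norm_sub_rev (Λ₁ t)] at he
  calc |L1 t i j - Λ₁N t i j| ≤ ‖L1 t - Λ₁ t‖ + ‖Λ₁N t - Λ₁ t‖ := he
    _ ≤ C * (1 / (N : ℝ)) + C' * (1 / (N : ℝ)) := add_le_add h h'
    _ = (C + C') / (N : ℝ) := by ring

end Params

end

lemma frob_le_of_abs_entry_le {n : ℕ} {M : Matrix (Fin n) (Fin n) ℝ} {c : ℝ} (hc : 0 ≤ c)
    (h : ∀ i j, |M i j| ≤ c) : frob M ≤ n * c := by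
  refine Real.sqrt_le_iff.2 ⟨by positivity, ?_⟩
  calc ∑ i, ∑ j, (M i j) ^ 2 ≤ ∑ _i : Fin n, ∑ _j : Fin n, c ^ 2 :=
        Finset.sum_le_sum fun i _ => Finset.sum_le_sum fun j _ => sq_le_sq'
          (abs_le.1 (h i j)).1 (abs_le.1 (h i j)).2
    _ = (n * c) ^ 2 := by simp; ring


/-- the solution Λ̌₁^N of the decentralized coefficient system is within
O(1/N) of the solution Λ₁^N of the rescaled system (ODE-Λ^N). -/
theorem checkLam1_close_to_Lam1N {n n₁ : ℕ} (p : Params n n₁) (hp : p.Standing)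
    (Λ₁ Λ₂ : ℝ → Matrix (Fin n) (Fin n) ℝ) (hLim : p.IsSolLim Λ₁ Λ₂) :
    ∃ N₁ : ℕ, 1 ≤ N₁ ∧ ∃ C : ℝ, 0 < C ∧
      ∀ N : ℕ, N₁ ≤ N →
        ∀ L1 L2 Λ₁N Λ₂N : ℝ → Matrix (Fin n) (Fin n) ℝ,
          p.IsSolCheckA N Λ₁ L1 L2 →
          p.IsSolLamN N Λ₁N Λ₂N →
          ∀ t ∈ Icc (0 : ℝ) p.T, frob (L1 t - Λ₁N t) ≤ C / (N : ℝ) := by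
  obtain ⟨N₁, hN₁, C, hC, H⟩ := Params.exists_entry_check_sub_rescaled_le hp.2.2.1.le hLim
  have hn : (0 : ℝ) < n := by exact_mod_cast hp.1
  refine ⟨N₁, hN₁, n * C, by positivity, fun N hN L1 L2 Λ₁N Λ₂N hL hΛN t ht => ?_⟩
  rw [mul_div_assoc]
  exact frob_le_of_abs_entry_le (by positivity) (H N hN L1 L2 Λ₁N Λ₂N hL hΛN t ht)

end LQ
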